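/- Let μ be a Borel probability measure on ℝ satisfying the basic assumptions and with finite first moment, let k ≥ 1, and let v ∈ (0,1)ᵏ be nondecreasing. Then the Bayesian approximation ratio of the percentile mechanism PM_v converges: lim_{n→∞} (∫_{ℝⁿ} SC_v d(μ^{⊗n})) / (∫_{ℝⁿ} SC_opt d(μ^{⊗n})) = W₁(μ, ν_{Q_v}) / (inf_{ν ∈ 𝒫_k(ℝ)} W₁(μ, ν)), and this limit is finite. -/

import Mathlib

open MeasureTheory Filter Topology ENNReal

/-- The 1-Wasserstein distance between two measures on ℝ, defined as the infimum of
transport costs over couplings. -/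
noncomputable def W1 (α β : Measure ℝ) : ℝ :=
  sInf {c : ℝ | ∃ π : Measure (ℝ × ℝ), IsProbabilityMeasure π ∧
    π.map Prod.fst = α ∧ π.map Prod.snd = β ∧ c = ∫ p, |p.1 - p.2| ∂π}

/-- The ∞-Wasserstein distance between two measures on ℝ. -/
noncomputable def Winf (α β : Measure ℝ) : ℝ :=
  sInf {c : ℝ | ∃ π : Measure (ℝ × ℝ), IsProbabilityMeasure π ∧
    π.map Prod.fst = α ∧ π.map Prod.snd = β ∧
    c = essSup (fun p : ℝ × ℝ => |p.1 - p.2|) π}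

/-- `Pk k` : probability measures on ℝ supported on at most `k` points. -/
def Pk (k : ℕ) : Set (Measure ℝ) :=
  {ν | IsProbabilityMeasure ν ∧ ∃ s : Finset ℝ, s.card ≤ k ∧ ν ((↑s : Set ℝ)ᶜ) = 0}

/-- Wasserstein projection distance of `μ` onto `k`-point measures. -/
noncomputable def projDist (k : ℕ) (μ : Measure ℝ) : ℝ :=
  sInf {c : ℝ | ∃ ν ∈ Pk k, c = W1 μ ν}

/-- Empirical measure of a tuple of points. -/
noncomputable def empMeas {n : ℕ} (x : Fin n → ℝ) : Measure ℝ :=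
  ((n : ℝ≥0∞))⁻¹ • ∑ i : Fin n, Measure.dirac (x i)

/-- Social cost of facility placement `y` for agents at `x`. -/
noncomputable def SC {n k : ℕ} (x : Fin n → ℝ) (y : Fin k → ℝ) : ℝ :=
  (n : ℝ)⁻¹ * ∑ i : Fin n, ⨅ j : Fin k, |x i - y j|

/-- Optimal social cost for `k` facilities. -/
noncomputable def SCopt (k : ℕ) {n : ℕ} (x : Fin n → ℝ) : ℝ :=
  ⨅ y : Fin k → ℝ, SC x y

/-- Topological support of a measure on ℝ. -/
def msupport (ν : Measure ℝ) : Set ℝ := {t : ℝ | ∀ U ∈ nhds t, ν U ≠ 0}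

/-- Cumulative distribution function of a measure on ℝ. -/
noncomputable def mcdf (μ : Measure ℝ) (t : ℝ) : ℝ := (μ (Set.Iic t)).toReal

/-- Quantile (generalized inverse c.d.f.) of a measure on ℝ. -/
noncomputable def mquantile (μ : Measure ℝ) (v : ℝ) : ℝ := sInf {t : ℝ | v ≤ mcdf μ t}

/-- Basic assumptions: `μ` is an absolutely continuous probability measure with density `ρ`,
supported on a (closed) interval `S`, with `ρ` positive on the interior of `S`, vanishing
outside `S`, and differentiable on `S`. -/
def BasicAssumptions (μ : Measure ℝ) : Prop :=
  IsProbabilityMeasure μ ∧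
  ∃ (ρ : ℝ → ℝ) (S : Set ℝ),
    μ = volume.withDensity (fun x => ENNReal.ofReal (ρ x)) ∧
    IsClosed S ∧ S.OrdConnected ∧ μ Sᶜ = 0 ∧
    (∀ x ∈ interior S, 0 < ρ x) ∧ (∀ x ∉ S, ρ x = 0) ∧
    DifferentiableOn ℝ ρ S

/-- The percentile mechanism: facility `j` is placed at the `(⌊(n-1)vⱼ⌋+1)`-th smallest
coordinate of `x`. -/
noncomputable def percentileMech {k : ℕ} (v : Fin k → ℝ) {n : ℕ} (x : Fin n → ℝ) :
    Fin k → ℝ :=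
  fun j =>
    if h : 0 < n then
      x (Tuple.sort x ⟨min ⌊((n : ℝ) - 1) * v j⌋₊ (n - 1),
        Nat.lt_of_le_of_lt (min_le_right _ _) (by omega)⟩)
    else 0

/-- Social cost of the percentile mechanism with percentile vector `v`. -/
noncomputable def SCv {k : ℕ} (v : Fin k → ℝ) {n : ℕ} (x : Fin n → ℝ) : ℝ :=
  SC x (percentileMech v x)

/-- Cumulative masses of the Voronoi cells of the points `y 0 < y 1 < ⋯ < y (k-1)`:
`cellBd μ y j = F_μ(z_j)` where `z_j = (y (j-1) + y j)/2` for `1 ≤ j ≤ k-1` (1-based),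
with the conventions `F_μ(z_0) = 0` and `F_μ(z_k) = 1`. -/
noncomputable def cellBd (μ : Measure ℝ) {k : ℕ} (y : Fin k → ℝ) (j : ℕ) : ℝ :=
  if h0 : j = 0 then 0
  else if hk : k ≤ j then 1
  else mcdf μ ((y ⟨j - 1, by omega⟩ + y ⟨j, by omega⟩) / 2)

/-- The measure `ν_{Q_v}`: atoms at the quantiles `F_μ^{[-1]}(vⱼ)` weighted by the masses of
their Voronoi cells. -/
noncomputable def nuQ (μ : Measure ℝ) {k : ℕ} (v : Fin k → ℝ) : Measure ℝ :=
  ∑ i : Fin k,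
    ENNReal.ofReal (cellBd μ (fun j => mquantile μ (v j)) ((i : ℕ) + 1) -
        cellBd μ (fun j => mquantile μ (v j)) (i : ℕ)) •
      Measure.dirac (mquantile μ (v i))

/-- Distance from `t` to the nearest of the points `y j`. -/
noncomputable def nearDist {k : ℕ} (y : Fin k → ℝ) (t : ℝ) : ℝ := ⨅ j : Fin k, |t - y j|

section NearDist

variable {k : ℕ} (y : Fin k → ℝ) (t : ℝ)

lemma nearDist_le (j : Fin k) : nearDist y t ≤ |t - y j| :=
  ciInf_le (Set.finite_range _).bddBelow j

lemma nearDist_nonneg : 0 ≤ nearDist y t := Real.iInf_nonneg fun _ => abs_nonneg _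

lemma exists_nearDist_eq [Nonempty (Fin k)] : ∃ j, |t - y j| = nearDist y t :=
  exists_eq_ciInf_of_finite

lemma nearDist_le_add [Nonempty (Fin k)] (y' : Fin k → ℝ) (t' : ℝ) :
    nearDist y t ≤ nearDist y' t' + |t - t'| + dist y y' := by
  obtain ⟨j, hj⟩ := exists_nearDist_eq y' t'
  have h1 := nearDist_le y t j
  have h2 : |y j - y' j| ≤ dist y y' := by
    rw [← Real.dist_eq]; exact dist_le_pi_dist y y' j
  have h3 : |t - y j| ≤ |t - t'| + |t' - y' j| + |y j - y' j| := by
    rw [abs_sub_comm (y j)]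
    calc |t - y j| = |(t - t') + (t' - y' j) + (y' j - y j)| := by ring_nf
      _ ≤ _ := abs_add_three _ _ _
  linarith

lemma continuous_nearDist [Nonempty (Fin k)] :
    Continuous fun p : (Fin k → ℝ) × ℝ => nearDist p.1 p.2 := by
  refine (LipschitzWith.of_le_add_mul 2 fun p p' => ?_).continuous
  have h := nearDist_le_add p.1 p.2 p'.1 p'.2
  have h1 : dist p.1 p'.1 ≤ dist p p' := le_max_left _ _
  have h2 : |p.2 - p'.2| ≤ dist p p' := le_max_right _ _
  push_cast
  linarith

lemma continuous_nearDist_right [Nonempty (Fin k)] : Continuous (nearDist y) :=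
  continuous_nearDist.comp (by fun_prop : Continuous fun s : ℝ => (y, s))

lemma nearDist_le_abs_add [Nonempty (Fin k)] : nearDist y t ≤ |t| + ‖y‖ := by
  obtain ⟨j⟩ := ‹Nonempty (Fin k)›
  have h1 := nearDist_le y t j
  have h2 := norm_le_pi_norm y j
  rw [Real.norm_eq_abs] at h2
  linarith [abs_sub t (y j)]

lemma nearDist_comp_perm (σ : Equiv.Perm (Fin k)) : nearDist (y ∘ σ) = nearDist y := by
  funext s
  exact σ.iInf_comp (g := fun j => |s - y j|)

lemma integrable_nearDist [Nonempty (Fin k)] {μ : Measure ℝ} [IsProbabilityMeasure μ]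
    (hint : Integrable (fun x : ℝ => |x|) μ) : Integrable (nearDist y) μ := by
  refine (hint.add (integrable_const ‖y‖)).mono'
    (continuous_nearDist_right y).aestronglyMeasurable (ae_of_all _ fun s => ?_)
  rw [Real.norm_eq_abs, abs_of_nonneg (nearDist_nonneg y s)]
  exact nearDist_le_abs_add y s

end NearDist

lemma SC_eq {n k : ℕ} (x : Fin n → ℝ) (y : Fin k → ℝ) :
    SC x y = (n : ℝ)⁻¹ * ∑ i, nearDist y (x i) := rfl

lemma SC_nonneg {n k : ℕ} (x : Fin n → ℝ) (y : Fin k → ℝ) : 0 ≤ SC x y :=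
  mul_nonneg (by positivity) (Finset.sum_nonneg fun i _ => nearDist_nonneg y (x i))

lemma bddBelow_range_SC {n : ℕ} (k : ℕ) (x : Fin n → ℝ) :
    BddBelow (Set.range fun y : Fin k → ℝ => SC x y) :=
  ⟨0, by rintro _ ⟨y, rfl⟩; exact SC_nonneg x y⟩

lemma SCopt_le {n k : ℕ} (x : Fin n → ℝ) (y : Fin k → ℝ) : SCopt k x ≤ SC x y :=
  ciInf_le (bddBelow_range_SC k x) y

lemma SCopt_nonneg {n : ℕ} (k : ℕ) (x : Fin n → ℝ) : 0 ≤ SCopt k x :=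
  Real.iInf_nonneg fun y => SC_nonneg x y

lemma SC_le_add {n k : ℕ} [Nonempty (Fin k)] (x : Fin n → ℝ) (y y' : Fin k → ℝ) :
    SC x y ≤ SC x y' + dist y y' := by
  rw [SC_eq, SC_eq]
  rcases Nat.eq_zero_or_pos n with rfl | hn
  · simp
  have hn' : (0 : ℝ) < n := by exact_mod_cast hn
  have h : ∑ i, nearDist y (x i) ≤ ∑ i, (nearDist y' (x i) + dist y y') :=
    Finset.sum_le_sum fun i _ => by simpa using nearDist_le_add y (x i) y' (x i)
  rw [Finset.sum_add_distrib, Finset.sum_const, Finset.card_univ, Fintype.card_fin,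
    nsmul_eq_mul] at h
  calc _ ≤ (n : ℝ)⁻¹ * (∑ i, nearDist y' (x i) + n * dist y y') := by gcongr
    _ = _ := by field_simp

lemma SC_le_mean_add {n k : ℕ} [Nonempty (Fin k)] (x : Fin n → ℝ) (y : Fin k → ℝ) :
    SC x y ≤ (n : ℝ)⁻¹ * ∑ i, |x i| + ‖y‖ := by
  rw [SC_eq]
  rcases Nat.eq_zero_or_pos n with rfl | hn
  · simp
  have hn' : (0 : ℝ) < n := by exact_mod_cast hn
  have h : ∑ i, nearDist y (x i) ≤ ∑ i, (|x i| + ‖y‖) :=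
    Finset.sum_le_sum fun i _ => nearDist_le_abs_add y (x i)
  rw [Finset.sum_add_distrib, Finset.sum_const, Finset.card_univ, Fintype.card_fin,
    nsmul_eq_mul] at h
  calc _ ≤ (n : ℝ)⁻¹ * (∑ i, |x i| + n * ‖y‖) := by gcongr
    _ = _ := by field_simp

lemma continuous_SC {n k : ℕ} [Nonempty (Fin k)] :
    Continuous fun p : (Fin n → ℝ) × (Fin k → ℝ) => SC p.1 p.2 := by
  simp only [SC_eq]
  refine continuous_const.mul (continuous_finsetSum _ fun i _ => ?_)
  exact continuous_nearDist.comp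
    (by fun_prop : Continuous fun p : (Fin n → ℝ) × (Fin k → ℝ) => (p.2, p.1 i))

lemma measurable_SCopt (n k : ℕ) [Nonempty (Fin k)] :
    Measurable fun x : Fin n → ℝ => SCopt k x := by
  refine UpperSemicontinuous.measurable
    (upperSemicontinuous_ciInf (fun x => bddBelow_range_SC k x) fun y => ?_)
  exact (continuous_SC.comp
    (by fun_prop : Continuous fun x : Fin n → ℝ => (x, y))).upperSemicontinuous

lemma exists_percentileMech_eq {n k : ℕ} (hn : 0 < n) {v : Fin k → ℝ} {j : Fin k}
    (hv : v j ∈ Set.Ioo (0 : ℝ) 1) (x : Fin n → ℝ) :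
    ∃ m : Fin n, (m : ℕ) = ⌊((n : ℝ) - 1) * v j⌋₊ ∧
      percentileMech v x j = x (Tuple.sort x m) := by
  have hn1 : (0 : ℝ) ≤ (n : ℝ) - 1 := by
    have : (1 : ℝ) ≤ n := by exact_mod_cast hn
    linarith
  have hfl : ⌊((n : ℝ) - 1) * v j⌋₊ ≤ n - 1 := by
    refine Nat.floor_le_of_le ?_
    rw [Nat.cast_sub hn, Nat.cast_one]
    exact mul_le_of_le_one_right hn1 hv.2.le
  refine ⟨⟨⌊((n : ℝ) - 1) * v j⌋₊, by omega⟩, rfl, ?_⟩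
  simp only [percentileMech, hn, dif_pos, min_eq_left hfl]

/-- The order statistic selected by the percentile mechanism is at most `t` iff enough coordinates
are at most `t`. -/
lemma percentileMech_le_iff {n k : ℕ} (hn : 0 < n) {v : Fin k → ℝ} {j : Fin k}
    (hv : v j ∈ Set.Ioo (0 : ℝ) 1) (x : Fin n → ℝ) (t : ℝ) :
    percentileMech v x j ≤ t ↔
      ((n : ℝ) - 1) * v j < ∑ i, (Set.Iic t).indicator (fun _ => (1 : ℝ)) (x i) := by
  have hnn : 0 ≤ ((n : ℝ) - 1) * v j := by
    have : (1 : ℝ) ≤ n := by exact_mod_cast hn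
    exact mul_nonneg (by linarith) hv.1.le
  obtain ⟨m, hm, hx⟩ := exists_percentileMech_eq hn hv x
  have hsum : ∑ i, (Set.Iic t).indicator (fun _ => (1 : ℝ)) (x i)
      = ((Finset.univ.filter fun i => x (Tuple.sort x i) ≤ t).card : ℝ) := by
    rw [← Equiv.sum_comp (Tuple.sort x), Finset.card_filter, Nat.cast_sum]
    exact Finset.sum_congr rfl fun i _ => by simp [Set.indicator_apply]
  have hmono := Tuple.monotone_sort x
  rw [hsum, ← Nat.floor_lt hnn, ← hm, hx]
  constructor
  · intro h
    have hsub : Finset.Iic m ⊆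
        Finset.univ.filter fun i => x (Tuple.sort x i) ≤ t := by
      intro i hi
      simp only [Finset.mem_filter, Finset.mem_univ, true_and]
      exact (hmono (Finset.mem_Iic.1 hi)).trans h
    have := Finset.card_le_card hsub
    rw [Fin.card_Iic] at this
    exact this
  · intro h
    by_contra hlt
    have hsub : (Finset.univ.filter fun i => x (Tuple.sort x i) ≤ t) ⊆
        Finset.Iio m := by
      intro i hi
      simp only [Finset.mem_filter, Finset.mem_univ, true_and] at hi
      rw [Finset.mem_Iio]
      by_contra hle
      exact hlt ((hmono (not_lt.1 hle)).trans hi)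
    have := Finset.card_le_card hsub
    rw [Fin.card_Iio] at this
    exact absurd h (by simpa using this)

lemma measurable_percentileMech {n k : ℕ} {v : Fin k → ℝ} (hv : ∀ j, v j ∈ Set.Ioo (0 : ℝ) 1) :
    Measurable fun x : Fin n → ℝ => percentileMech v x := by
  refine measurable_pi_iff.2 fun j => ?_
  rcases Nat.eq_zero_or_pos n with rfl | hn
  · simp [percentileMech]
  refine measurable_of_Iic fun t => ?_
  have : (fun x : Fin n → ℝ => percentileMech v x j) ⁻¹' Set.Iic t = {x |
      ((n : ℝ) - 1) * v j < ∑ i, (Set.Iic t).indicator (fun _ => (1 : ℝ)) (x i)} := by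
    ext x
    exact percentileMech_le_iff hn (hv j) x t
  rw [this]
  refine measurableSet_lt measurable_const (Finset.measurable_sum _ fun i _ => ?_)
  exact (measurable_const.indicator measurableSet_Iic).comp (measurable_pi_apply i)

lemma measurable_SCv {n k : ℕ} [Nonempty (Fin k)] {v : Fin k → ℝ}
    (hv : ∀ j, v j ∈ Set.Ioo (0 : ℝ) 1) : Measurable fun x : Fin n → ℝ => SCv v x := by
  have h : Measurable fun x : Fin n → ℝ => (x, percentileMech v x) :=
    measurable_id.prodMk (measurable_percentileMech hv)
  have h' : Measurable fun p : (Fin n → ℝ) × (Fin k → ℝ) => SC p.1 p.2 :=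
    continuous_SC.measurable
  have h'' : (fun x : Fin n → ℝ => SCv v x) =
      (fun p : (Fin n → ℝ) × (Fin k → ℝ) => SC p.1 p.2) ∘ fun x => (x, percentileMech v x) := rfl
  rw [h'']
  exact h'.comp h

lemma mul_sort_le_sum_abs {n : ℕ} (x : Fin n → ℝ) (m : Fin n) :
    ((n : ℝ) - m) * x (Tuple.sort x m) ≤ ∑ i, |x i| := by
  have hmono := Tuple.monotone_sort x
  rw [← Equiv.sum_comp (Tuple.sort x) fun i => |x i|]
  calc ((n : ℝ) - m) * x (Tuple.sort x m) = ∑ i ∈ Finset.Ici m, x (Tuple.sort x m) := by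
        rw [Finset.sum_const, Fin.card_Ici, nsmul_eq_mul, Nat.cast_sub m.2.le]
    _ ≤ ∑ i ∈ Finset.Ici m, |x (Tuple.sort x i)| :=
        Finset.sum_le_sum fun i hi => (hmono (Finset.mem_Ici.1 hi)).trans (le_abs_self _)
    _ ≤ _ := Finset.sum_le_sum_of_subset_of_nonneg (Finset.subset_univ _)
        fun _ _ _ => abs_nonneg _

lemma mul_neg_sort_le_sum_abs {n : ℕ} (x : Fin n → ℝ) (m : Fin n) :
    ((m : ℝ) + 1) * -x (Tuple.sort x m) ≤ ∑ i, |x i| := by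
  have hmono := Tuple.monotone_sort x
  rw [← Equiv.sum_comp (Tuple.sort x) fun i => |x i|]
  calc ((m : ℝ) + 1) * -x (Tuple.sort x m) = ∑ i ∈ Finset.Iic m, -x (Tuple.sort x m) := by
        rw [Finset.sum_const, Fin.card_Iic, nsmul_eq_mul]; push_cast; rfl
    _ ≤ ∑ i ∈ Finset.Iic m, |x (Tuple.sort x i)| :=
        Finset.sum_le_sum fun i hi =>
          (neg_le_neg (hmono (Finset.mem_Iic.1 hi))).trans (neg_le_abs _)
    _ ≤ _ := Finset.sum_le_sum_of_subset_of_nonneg (Finset.subset_univ _)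
        fun _ _ _ => abs_nonneg _

lemma abs_le_mean_of_rank_bounds {n m a u S : ℝ} (hn : 1 ≤ n) (hm : 0 ≤ m) (hu0 : 0 < u)
    (hu1 : u < 1) (hlow : m ≤ (n - 1) * u) (hupp : (n - 1) * u < m + 1)
    (h1 : (n - m) * a ≤ S) (h2 : (m + 1) * -a ≤ S) (hS : 0 ≤ S) :
    |a| ≤ (2 / u + 1 / (1 - u)) * (n⁻¹ * S) := by
  have hn0 : 0 < n := by linarith
  have hM0 : 0 ≤ n⁻¹ * S := by positivity
  have hSM : S = n * (n⁻¹ * S) := by field_simp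
  generalize n⁻¹ * S = M at *
  subst hSM
  have hw : 0 < 1 - u := by linarith
  have hA : 0 ≤ 2 / u * M := by positivity
  have hB : 0 ≤ 1 / (1 - u) * M := by positivity
  rw [add_mul]
  rcases le_total 0 a with ha | ha
  · rw [abs_of_nonneg ha]
    have h0 : n * (1 - u) ≤ n - m := by linarith
    have h3 : n * ((1 - u) * a) ≤ n * M := by
      linarith [mul_le_mul_of_nonneg_right h0 ha]
    have h4 := le_of_mul_le_mul_left h3 hn0
    have h5 : a ≤ 1 / (1 - u) * M := by
      rw [one_div, ← div_eq_inv_mul, le_div_iff₀ hw]; linarith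
    linarith
  · rw [abs_of_nonpos ha]
    have h0 : n * u / 2 ≤ m + 1 := by linarith
    have h3 : n * (u / 2 * (-a)) ≤ n * M := by
      linarith [mul_le_mul_of_nonneg_right h0 (neg_nonneg.2 ha)]
    have h4 := le_of_mul_le_mul_left h3 hn0
    have h5 : -a ≤ 2 / u * M := by
      rw [div_mul_eq_mul_div, le_div_iff₀ hu0]; linarith
    linarith

lemma abs_percentileMech_le {n k : ℕ} {v : Fin k → ℝ} {j : Fin k}
    (hv : v j ∈ Set.Ioo (0 : ℝ) 1) (x : Fin n → ℝ) :
    |percentileMech v x j| ≤ (2 / v j + 1 / (1 - v j)) * ((n : ℝ)⁻¹ * ∑ i, |x i|) := by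
  rcases Nat.eq_zero_or_pos n with rfl | hn
  · simp [percentileMech]
  have hn1 : (1 : ℝ) ≤ n := by exact_mod_cast hn
  have hnn : 0 ≤ ((n : ℝ) - 1) * v j := mul_nonneg (by linarith) hv.1.le
  obtain ⟨m, hm, hx⟩ := exists_percentileMech_eq hn hv x
  have hlow := Nat.floor_le hnn
  have hupp := Nat.lt_floor_add_one (((n : ℝ) - 1) * v j)
  rw [← hm] at hlow hupp
  rw [hx]
  exact abs_le_mean_of_rank_bounds hn1 (Nat.cast_nonneg _) hv.1 hv.2 hlow hupp
    (mul_sort_le_sum_abs x m) (mul_neg_sort_le_sum_abs x m)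
    (Finset.sum_nonneg fun i _ => abs_nonneg _)

/-- Transporting `μ` to a measure carried by the points `y j` costs at least the mean distance to
the nearest of these points. -/
lemma integral_nearDist_le_cost {k : ℕ} [Nonempty (Fin k)] {μ ν : Measure ℝ}
    [IsProbabilityMeasure μ] (hint : Integrable (fun x : ℝ => |x|) μ) {y : Fin k → ℝ}
    (hν : ∀ᵐ b ∂ν, ∃ j, b = y j) {π : Measure (ℝ × ℝ)} [IsProbabilityMeasure π]
    (h1 : π.map Prod.fst = μ) (h2 : π.map Prod.snd = ν) :
    ∫ t, nearDist y t ∂μ ≤ ∫ p, |p.1 - p.2| ∂π := by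
  have hsnd : ∀ᵐ p ∂π, ∃ j, p.2 = y j := ae_of_ae_map measurable_snd.aemeasurable (h2 ▸ hν)
  have hfst : Integrable (fun p : ℝ × ℝ => |p.1|) π := by
    rw [← h1] at hint
    exact hint.comp_measurable measurable_fst
  have hnd : Integrable (fun p : ℝ × ℝ => nearDist y p.1) π := by
    have := integrable_nearDist y hint
    rw [← h1] at this
    exact this.comp_measurable measurable_fst
  have hcost : Integrable (fun p : ℝ × ℝ => |p.1 - p.2|) π := by
    refine (hfst.add (integrable_const ‖y‖)).mono' (by fun_prop) ?_
    filter_upwards [hsnd] with p ⟨j, hj⟩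
    have := norm_le_pi_norm y j
    rw [Real.norm_eq_abs] at this
    rw [Real.norm_eq_abs, abs_abs, hj]
    exact (abs_sub _ _).trans (by simpa using this)
  rw [← h1, integral_map measurable_fst.aemeasurable
    (continuous_nearDist_right y).aestronglyMeasurable]
  refine integral_mono_ae hnd hcost ?_
  filter_upwards [hsnd] with p ⟨j, hj⟩
  rw [hj]
  exact nearDist_le y p.1 j

lemma integral_nearDist_le_W1 {k : ℕ} [Nonempty (Fin k)] {μ ν : Measure ℝ}
    [IsProbabilityMeasure μ] [IsProbabilityMeasure ν] (hint : Integrable (fun x : ℝ => |x|) μ)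
    {y : Fin k → ℝ} (hν : ∀ᵐ b ∂ν, ∃ j, b = y j) :
    ∫ t, nearDist y t ∂μ ≤ W1 μ ν := by
  refine le_csInf ⟨_, μ.prod ν, inferInstance, ?_, ?_, rfl⟩ ?_
  · simp
  · simp
  · rintro c ⟨π, hπ, h1, h2, rfl⟩
    exact integral_nearDist_le_cost hint hν h1 h2

lemma W1_le_cost {μ ν : Measure ℝ} {π : Measure (ℝ × ℝ)} [IsProbabilityMeasure π]
    (h1 : π.map Prod.fst = μ) (h2 : π.map Prod.snd = ν) :
    W1 μ ν ≤ ∫ p, |p.1 - p.2| ∂π := by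
  refine csInf_le ⟨0, ?_⟩ ⟨π, inferInstance, h1, h2, rfl⟩
  rintro _ ⟨π', -, -, -, rfl⟩
  exact integral_nonneg fun p => abs_nonneg _

section Voronoi

variable (μ : Measure ℝ) {k : ℕ} (y : Fin k → ℝ)

/-- The union of the first `m` Voronoi cells of the points `y`. -/
noncomputable def cellUnion (m : ℕ) : Set ℝ :=
  if _ : m = 0 then ∅
  else if _ : k ≤ m then Set.univ
  else Set.Iic ((y ⟨m - 1, by omega⟩ + y ⟨m, by omega⟩) / 2)

/-- The measure putting at each `y i` the mass of its Voronoi cell. -/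
noncomputable def voronoiMeasure : Measure ℝ :=
  ∑ i : Fin k, ENNReal.ofReal (cellBd μ y ((i : ℕ) + 1) - cellBd μ y (i : ℕ)) •
    Measure.dirac (y i)

/-- The plan sending each Voronoi cell to its centre. -/
noncomputable def voronoiPlan : Measure (ℝ × ℝ) :=
  ∑ i : Fin k, (μ.restrict (cellUnion y ((i : ℕ) + 1) \ cellUnion y (i : ℕ))).map
    fun t => (t, y i)

lemma measurableSet_cellUnion (m : ℕ) : MeasurableSet (cellUnion y m) := by
  unfold cellUnion
  split_ifs
  exacts [.empty, .univ, measurableSet_Iic]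

lemma measureReal_cellUnion [IsProbabilityMeasure μ] (m : ℕ) :
    μ.real (cellUnion y m) = cellBd μ y m := by
  unfold cellUnion cellBd
  split_ifs <;> simp [mcdf, Measure.real]

variable {y}

lemma cellUnion_subset_succ (hy : Monotone y) (m : ℕ) :
    cellUnion y m ⊆ cellUnion y (m + 1) := by
  unfold cellUnion
  split_ifs <;> first | contradiction | omega | simp only [Set.empty_subset, Set.subset_univ] | skip
  refine Set.Iic_subset_Iic.2 ?_
  have h1 : y ⟨m - 1, by omega⟩ ≤ y ⟨m + 1 - 1, by omega⟩ := hy (Fin.le_def.2 (by simp))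
  have h2 : y ⟨m, by omega⟩ ≤ y ⟨m + 1, by omega⟩ := hy (Fin.le_def.2 (by simp))
  linarith

lemma nearDist_eq_of_mem_cell (hy : Monotone y) (i : Fin k) {t : ℝ}
    (ht : t ∈ cellUnion y ((i : ℕ) + 1) \ cellUnion y (i : ℕ)) :
    nearDist y t = |t - y i| := by
  have : Nonempty (Fin k) := ⟨i⟩
  refine le_antisymm (nearDist_le y t i) (le_ciInf fun j => ?_)
  obtain ⟨h1, h2⟩ := ht
  rcases lt_trichotomy i j with hij | rfl | hij
  · have hij' : (i : ℕ) < j := hij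
    have hj := j.2
    have h3 : t ≤ (y i + y j) / 2 := by
      rw [cellUnion, dif_neg (by omega), dif_neg (by omega)] at h1
      refine (Set.mem_Iic.1 h1).trans ?_
      have h4 : y ⟨(i : ℕ) + 1 - 1, by omega⟩ = y i := by congr
      have h5 : y ⟨(i : ℕ) + 1, by omega⟩ ≤ y j := hy (Fin.le_def.2 (by simpa using hij'))
      linarith
    have h6 := hy hij.le
    rw [abs_sub_comm t (y j), abs_of_nonneg (by linarith : 0 ≤ y j - t)]
    exact abs_le.2 ⟨by linarith, by linarith⟩
  · exact le_rfl
  · have hij' : (j : ℕ) < i := hij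
    have hi := i.2
    have h3 : (y j + y i) / 2 < t := by
      rw [cellUnion, dif_neg (by omega), dif_neg (by omega)] at h2
      refine lt_of_le_of_lt ?_ (not_le.1 (fun h => h2 (Set.mem_Iic.2 h)))
      have h5 : y j ≤ y ⟨(i : ℕ) - 1, by omega⟩ := hy (Fin.le_def.2 (by simp; omega))
      have h4 : y ⟨(i : ℕ), by omega⟩ = y i := by congr
      linarith
    have h6 := hy hij.le
    rw [abs_of_nonneg (by linarith : 0 ≤ t - y j)]
    exact abs_le.2 ⟨by linarith, by linarith⟩

lemma sum_restrict_cellUnion (hy : Monotone y) (m : ℕ) :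
    ∑ i ∈ Finset.range m, μ.restrict (cellUnion y (i + 1) \ cellUnion y i) =
      μ.restrict (cellUnion y m) := by
  induction m with
  | zero => simp [cellUnion]
  | succ m ih =>
    rw [Finset.sum_range_succ, ih]
    have h := μ.restrict_inter_add_sdiff (cellUnion y (m + 1)) (measurableSet_cellUnion y m)
    rwa [Set.inter_eq_self_of_subset_right (cellUnion_subset_succ hy m)] at h

lemma sum_restrict_cells [Nonempty (Fin k)] (hy : Monotone y) :
    ∑ i : Fin k, μ.restrict (cellUnion y ((i : ℕ) + 1) \ cellUnion y (i : ℕ)) = μ := by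
  have hk : k ≠ 0 := Fin.pos_iff_nonempty.2 ‹_› |>.ne'
  rw [Fin.sum_univ_eq_sum_range
    (fun i => μ.restrict (cellUnion y (i + 1) \ cellUnion y i)) k, sum_restrict_cellUnion μ hy]
  simp [cellUnion, hk]

lemma map_fst_voronoiPlan [Nonempty (Fin k)] (hy : Monotone y) :
    (voronoiPlan μ y).map Prod.fst = μ := by
  rw [voronoiPlan, Measure.map_finset_sum' measurable_fst.aemeasurable]
  conv_rhs => rw [← sum_restrict_cells μ hy]
  refine Finset.sum_congr rfl fun i _ => ?_
  rw [Measure.map_map measurable_fst (by fun_prop)]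
  exact Measure.map_id

lemma map_snd_voronoiPlan [IsProbabilityMeasure μ] (hy : Monotone y) :
    (voronoiPlan μ y).map Prod.snd = voronoiMeasure μ y := by
  rw [voronoiPlan, Measure.map_finset_sum' measurable_snd.aemeasurable, voronoiMeasure]
  refine Finset.sum_congr rfl fun i _ => ?_
  rw [Measure.map_map measurable_snd (by fun_prop)]
  have : (Prod.snd ∘ fun t : ℝ => (t, y i)) = fun _ => y i := rfl
  rw [this, Measure.map_const, Measure.restrict_apply_univ, ← measureReal_cellUnion,
    ← measureReal_cellUnion, ← measureReal_sdiff (cellUnion_subset_succ hy i)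
      (measurableSet_cellUnion y i), ofReal_measureReal]

lemma isProbabilityMeasure_voronoiPlan [IsProbabilityMeasure μ] [Nonempty (Fin k)]
    (hy : Monotone y) : IsProbabilityMeasure (voronoiPlan μ y) := by
  have h : IsProbabilityMeasure ((voronoiPlan μ y).map Prod.fst) := by
    rw [map_fst_voronoiPlan μ hy]; infer_instance
  exact (Measure.isProbabilityMeasure_map_iff measurable_fst.aemeasurable).1 h

lemma isProbabilityMeasure_voronoiMeasure [IsProbabilityMeasure μ] [Nonempty (Fin k)]
    (hy : Monotone y) : IsProbabilityMeasure (voronoiMeasure μ y) := by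
  have := isProbabilityMeasure_voronoiPlan μ hy
  rw [← map_snd_voronoiPlan μ hy]
  exact Measure.isProbabilityMeasure_map measurable_snd.aemeasurable

lemma ae_voronoiMeasure : ∀ᵐ b ∂voronoiMeasure μ y, ∃ j, b = y j := by
  rw [voronoiMeasure, ae_finsetSum_measure_iff]
  intro i _
  refine Measure.ae_smul_measure ?_ _
  rw [ae_dirac_eq]
  exact ⟨i, rfl⟩

lemma cost_voronoiPlan [Nonempty (Fin k)] (hy : Monotone y) :
    ∫ p, |p.1 - p.2| ∂(voronoiPlan μ y) = ∫ t, nearDist y t ∂μ := by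
  conv_rhs => rw [← map_fst_voronoiPlan μ hy]
  rw [integral_map measurable_fst.aemeasurable
    (continuous_nearDist_right y).aestronglyMeasurable]
  refine integral_congr_ae ?_
  change ∀ᵐ p ∂(voronoiPlan μ y), |p.1 - p.2| = nearDist y p.1
  rw [voronoiPlan, ae_finsetSum_measure_iff]
  intro i _
  rw [ae_map_iff (by fun_prop)]
  · refine (ae_restrict_iff' ((measurableSet_cellUnion y _).diff
      (measurableSet_cellUnion y _))).2 (ae_of_all _ fun t ht => ?_)
    exact (nearDist_eq_of_mem_cell hy i ht).symm
  · exact measurableSet_eq_fun (by fun_prop)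
      ((continuous_nearDist_right y).measurable.comp measurable_fst)

lemma W1_voronoiMeasure [IsProbabilityMeasure μ] [Nonempty (Fin k)]
    (hint : Integrable (fun x : ℝ => |x|) μ) (hy : Monotone y) :
    W1 μ (voronoiMeasure μ y) = ∫ t, nearDist y t ∂μ := by
  have := isProbabilityMeasure_voronoiPlan μ hy
  have := isProbabilityMeasure_voronoiMeasure μ hy
  refine le_antisymm ?_ (integral_nearDist_le_W1 hint (ae_voronoiMeasure μ))
  rw [← cost_voronoiPlan μ hy]
  exact W1_le_cost (map_fst_voronoiPlan μ hy) (map_snd_voronoiPlan μ hy)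

lemma voronoiMeasure_mem_Pk [IsProbabilityMeasure μ] [Nonempty (Fin k)] (hy : Monotone y) :
    voronoiMeasure μ y ∈ Pk k := by
  classical
  refine ⟨isProbabilityMeasure_voronoiMeasure μ hy, Finset.univ.image y, ?_, ?_⟩
  · simpa using Finset.card_image_le (s := Finset.univ) (f := y)
  · have h := ae_voronoiMeasure μ (y := y)
    rw [ae_iff] at h
    refine measure_mono_null (fun b hb => ?_) h
    rintro ⟨j, rfl⟩
    exact hb (by simp)

end Voronoi

lemma projDist_eq_iInf {k : ℕ} [Nonempty (Fin k)] {μ : Measure ℝ} [IsProbabilityMeasure μ]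
    (hint : Integrable (fun x : ℝ => |x|) μ) :
    projDist k μ = ⨅ y : Fin k → ℝ, ∫ t, nearDist y t ∂μ := by
  have hbdd : BddBelow (Set.range fun y : Fin k → ℝ => ∫ t, nearDist y t ∂μ) :=
    ⟨0, by rintro _ ⟨y, rfl⟩; exact integral_nonneg (nearDist_nonneg y)⟩
  have hlow : ∀ ν ∈ Pk k, ⨅ y : Fin k → ℝ, ∫ t, nearDist y t ∂μ ≤ W1 μ ν := by
    rintro ν ⟨hν, s, hs, hs0⟩
    have hne : s.Nonempty := by
      rw [Finset.nonempty_iff_ne_empty]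
      rintro rfl
      simp at hs0
    have : Nonempty s := hne.to_subtype
    obtain ⟨f, hf⟩ : ∃ f : Fin k → s, Function.Surjective f := by
      obtain ⟨e⟩ : Nonempty (s ↪ Fin k) :=
        Function.Embedding.nonempty_of_card_le (by simpa using hs)
      exact ⟨Function.invFun e, Function.invFun_surjective e.injective⟩
    refine (ciInf_le hbdd fun j => (f j : ℝ)).trans (integral_nearDist_le_W1 hint ?_)
    filter_upwards [mem_ae_iff.2 hs0] with b hb
    obtain ⟨j, hj⟩ := hf ⟨b, hb⟩
    exact ⟨j, by rw [hj]⟩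
  refine le_antisymm (le_ciInf fun y => ?_) ?_
  · have hmono : Monotone (y ∘ Tuple.sort y) := Tuple.monotone_sort y
    rw [← nearDist_comp_perm y (Tuple.sort y), ← W1_voronoiMeasure μ hint hmono]
    refine csInf_le ⟨⨅ y : Fin k → ℝ, ∫ t, nearDist y t ∂μ, ?_⟩
      ⟨_, voronoiMeasure_mem_Pk μ hmono, rfl⟩
    rintro _ ⟨ν, hν, rfl⟩
    exact hlow ν hν
  · refine le_csInf ⟨_, _, voronoiMeasure_mem_Pk μ (y := fun _ => 0) monotone_const, rfl⟩ ?_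
    rintro _ ⟨ν, hν, rfl⟩
    exact hlow ν hν

/-- A measure without concentration at small scales cannot be approximated arbitrarily well by
finitely many points. -/
lemma projDist_pos {k : ℕ} [Nonempty (Fin k)] {μ : Measure ℝ} [IsProbabilityMeasure μ]
    (hint : Integrable (fun x : ℝ => |x|) μ) (hac : μ ≪ volume) : 0 < projDist k μ := by
  obtain ⟨δ, hδ, hs⟩ : ∃ δ > (0 : ℝ≥0∞), ∀ s, volume s < δ → μ s < 1 / 2 := by
    have hfin : ∫⁻ x, μ.rnDeriv volume x ≠ ∞ := by
      rw [Measure.lintegral_rnDeriv hac]; simp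
    obtain ⟨δ, hδ, h⟩ := exists_pos_setLIntegral_lt_of_measure_lt hfin
      (ε := 1 / 2) (by simp)
    refine ⟨δ, hδ, fun s hs => ?_⟩
    have := h s hs
    rwa [Measure.setLIntegral_rnDeriv hac] at this
  have hk : (0 : ℝ) < k := by exact_mod_cast Fin.pos_iff_nonempty.2 ‹Nonempty (Fin k)›
  obtain ⟨r, hr, hrδ⟩ : ∃ r : ℝ, 0 < r ∧ ENNReal.ofReal (k * (2 * r)) < δ := by
    obtain ⟨c, hc0, hcδ⟩ := exists_between hδ
    have hct : c ≠ ∞ := hcδ.ne_top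
    refine ⟨c.toReal / (2 * k), div_pos (ENNReal.toReal_pos hc0.ne' hct) (by positivity), ?_⟩
    have : (k : ℝ) * (2 * (c.toReal / (2 * k))) = c.toReal := by field_simp
    rwa [this, ENNReal.ofReal_toReal hct]
  have hball : ∀ y : Fin k → ℝ, 1 / 2 ≤ μ {t | r ≤ nearDist y t} := by
    intro y
    have hU : μ (⋃ j, Metric.ball (y j) r) < 1 / 2 := by
      refine hs _ (lt_of_le_of_lt ?_ hrδ)
      refine (measure_iUnion_fintype_le _ _).trans ?_
      simp only [Real.volume_ball, Finset.sum_const, Finset.card_univ, Fintype.card_fin,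
        nsmul_eq_mul]
      rw [ENNReal.ofReal_mul hk.le, ENNReal.ofReal_natCast]
    have hsub : (⋃ j, Metric.ball (y j) r)ᶜ ⊆ {t | r ≤ nearDist y t} := by
      intro t ht
      change r ≤ nearDist y t
      refine le_ciInf fun j => ?_
      by_contra hlt
      exact ht (Set.mem_iUnion.2 ⟨j, by rw [Metric.mem_ball, Real.dist_eq]; exact not_le.1 hlt⟩)
    refine le_trans ?_ (measure_mono hsub)
    rw [prob_compl_eq_one_sub (MeasurableSet.iUnion fun j => Metric.isOpen_ball.measurableSet)]
    calc (1 / 2 : ℝ≥0∞) = 1 - 1 / 2 := by simp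
      _ ≤ _ := tsub_le_tsub_left hU.le 1
  rw [projDist_eq_iInf hint]
  refine lt_of_lt_of_le (by positivity : 0 < r / 2) (le_ciInf (ι := Fin k → ℝ) fun y => ?_)
  have h := mul_meas_ge_le_integral_of_nonneg (ae_of_all μ (nearDist_nonneg y))
    (integrable_nearDist y hint) r
  have h2 : (1 / 2 : ℝ) ≤ μ.real {t | r ≤ nearDist y t} := by
    have := ENNReal.toReal_mono (measure_ne_top μ _) (hball y)
    simpa [Measure.real] using this
  nlinarith

lemma mcdf_eq_cdf (μ : Measure ℝ) [IsProbabilityMeasure μ] : mcdf μ = ProbabilityTheory.cdf μ :=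
  funext fun t => (ProbabilityTheory.cdf_eq_real μ t).symm

/-- A quantile is separated from its neighbours by the distribution function. -/
lemma mcdf_lt_of_lt_mquantile {μ : Measure ℝ} [IsProbabilityMeasure μ] {u r : ℝ} (hu : 0 < u)
    (hr : r < mquantile μ u) : mcdf μ r < u := by
  have hbdd : BddBelow {t : ℝ | u ≤ mcdf μ t} := by
    have h : Tendsto (mcdf μ) atBot (𝓝 0) := by
      rw [mcdf_eq_cdf]
      exact ProbabilityTheory.tendsto_cdf_atBot μ
    obtain ⟨a, ha⟩ := eventually_atBot.1 (h.eventually (gt_mem_nhds hu))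
    exact ⟨a, fun t ht => le_of_lt (by
      by_contra hle
      exact absurd (ha t (not_lt.1 hle)) (not_lt.2 ht))⟩
  by_contra hle
  exact absurd (csInf_le hbdd (not_lt.1 hle)) (not_le.2 hr)

lemma mcdf_mono (μ : Measure ℝ) [IsProbabilityMeasure μ] : Monotone (mcdf μ) :=
  mcdf_eq_cdf μ ▸ ProbabilityTheory.monotone_cdf μ

lemma exists_le_mcdf (μ : Measure ℝ) [IsProbabilityMeasure μ] {u : ℝ} (hu : u < 1) :
    {t : ℝ | u ≤ mcdf μ t}.Nonempty := by
  have h : Tendsto (mcdf μ) atTop (𝓝 1) := by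
    rw [mcdf_eq_cdf]
    exact ProbabilityTheory.tendsto_cdf_atTop μ
  obtain ⟨a, ha⟩ := (h.eventually (lt_mem_nhds hu)).exists
  exact ⟨a, ha.le⟩

lemma lt_mcdf_of_mquantile_lt {μ : Measure ℝ} [IsProbabilityMeasure μ]
    (hinc : ∀ q t : ℝ, q < t → 0 < μ (Set.Iic q) → 0 < μ (Set.Ioi q) → 0 < μ (Set.Ioc q t))
    {u r : ℝ} (hu : u ∈ Set.Ioo (0 : ℝ) 1) (hr : mquantile μ u < r) : u < mcdf μ r := by
  obtain ⟨t, ht, htr⟩ := exists_lt_of_csInf_lt (exists_le_mcdf μ hu.2) hr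
  have ht' : u ≤ μ.real (Set.Iic t) := ht
  have htpos : 0 < μ.real (Set.Iic t) := hu.1.trans_le ht'
  rcases eq_zero_or_pos (μ (Set.Ioi t)) with h0 | h0
  · have h1 : mcdf μ t = 1 := by
      have : μ.real (Set.Iic t)ᶜ = 0 := by simp [Measure.real, h0]
      rw [probReal_compl_eq_one_sub measurableSet_Iic] at this
      change μ.real (Set.Iic t) = 1
      linarith
    exact hu.2.trans_le (h1 ▸ mcdf_mono μ htr.le)
  · have h2 := hinc t r htr (ENNReal.toReal_pos_iff.1 htpos).1 h0
    have h3 : 0 < μ.real (Set.Ioc t r) := ENNReal.toReal_pos h2.ne' (measure_ne_top μ _)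
    have h4 : μ.real (Set.Iic r) = μ.real (Set.Iic t) + μ.real (Set.Ioc t r) := by
      rw [← Set.Iic_union_Ioc_eq_Iic htr.le, measureReal_union _ measurableSet_Ioc]
      exact Set.Iic_disjoint_Ioc le_rfl
    change u < μ.real (Set.Iic r)
    linarith

lemma mquantile_mono {μ : Measure ℝ} [IsProbabilityMeasure μ] {u u' : ℝ} (hu : 0 < u)
    (hu' : u' < 1) (h : u ≤ u') : mquantile μ u ≤ mquantile μ u' := by
  refine le_csInf (exists_le_mcdf μ hu') fun t ht => ?_
  by_contra hlt
  exact absurd (mcdf_lt_of_lt_mquantile hu (not_le.1 hlt)) (not_lt.2 (h.trans ht))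

/-- Under the basic assumptions the distribution function increases strictly wherever it is
neither `0` nor `1`. -/
lemma BasicAssumptions.measure_Ioc_pos {μ : Measure ℝ} (hμ : BasicAssumptions μ) (q t : ℝ)
    (hqt : q < t) (h1 : 0 < μ (Set.Iic q)) (h2 : 0 < μ (Set.Ioi q)) : 0 < μ (Set.Ioc q t) := by
  obtain ⟨hprob, ρ, S, hρ, -, hS, hSc, hpos, -, hdiff⟩ := hμ
  have key : ∀ A : Set ℝ, 0 < μ A → ∃ a ∈ A, a ∈ S := by
    intro A hA
    by_contra hne
    push Not at hne
    exact hA.ne' (measure_mono_null (fun a ha => hne a ha) hSc)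
  obtain ⟨a, ha, haS⟩ := key _ h1
  obtain ⟨b, hb, hbS⟩ := key _ h2
  set c := min b t
  have hqc : q < c := lt_min hb hqt
  have hsub : Set.Ioo q c ⊆ interior S := by
    refine interior_maximal (fun s hs => hS.out haS hbS ⟨ha.trans hs.1.le, ?_⟩) isOpen_Ioo
    exact hs.2.le.trans (min_le_left _ _)
  have hIoo : 0 < μ (Set.Ioo q c) := by
    rw [pos_iff_ne_zero, hρ, withDensity_apply _ measurableSet_Ioo]
    intro h0
    have hcont : ContinuousOn ρ (Set.Ioo q c) :=
      (hdiff.mono (hsub.trans interior_subset)).continuousOn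
    rw [lintegral_eq_zero_iff' (hcont.aemeasurable measurableSet_Ioo).ennreal_ofReal,
      Filter.EventuallyEq, ae_restrict_iff' measurableSet_Ioo] at h0
    have hvol : volume (Set.Ioo q c) = 0 := by
      refine measure_mono_null (fun s hs => ?_) (ae_iff.1 h0)
      simp only [Set.mem_ofPred_eq, Classical.not_imp]
      refine ⟨hs, ?_⟩
      simpa using hpos s (hsub hs)
    rw [Real.volume_Ioo, ENNReal.ofReal_eq_zero] at hvol
    linarith
  refine hIoo.trans_le (measure_mono fun s hs => ⟨hs.1, ?_⟩)
  exact hs.2.le.trans (min_le_right _ _)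

lemma BasicAssumptions.absolutelyContinuous {μ : Measure ℝ} (hμ : BasicAssumptions μ) :
    μ ≪ volume := by
  obtain ⟨-, ρ, -, hρ, -⟩ := hμ
  rw [hρ]
  exact withDensity_absolutelyContinuous _ _

/-- Dominated convergence to a constant, with a dominating sequence converging in mean. -/
lemma tendsto_integral_of_dominated_seq {Ω : Type*} [MeasurableSpace Ω] {P : Measure Ω}
    [IsProbabilityMeasure P] {f g : ℕ → Ω → ℝ} {a c : ℝ} (hf : ∀ n, Measurable (f n))
    (hf0 : ∀ n ω, 0 ≤ f n ω) (hfg : ∀ n ω, f n ω ≤ g n ω) (hg : ∀ n, Integrable (g n) P)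
    (hlim : ∀ᵐ ω ∂P, Tendsto (fun n => f n ω) atTop (𝓝 a)) (hac : a ≤ c)
    (hgc : Tendsto (fun n => ∫ ω, |g n ω - c| ∂P) atTop (𝓝 0)) :
    Tendsto (fun n => ∫ ω, f n ω ∂P) atTop (𝓝 a) := by
  have hfint : ∀ n, Integrable (f n) P := fun n =>
    (hg n).mono' (hf n).aestronglyMeasurable
      (ae_of_all _ fun ω => by rw [Real.norm_eq_abs, abs_of_nonneg (hf0 n ω)]; exact hfg n ω)
  have h0c : ∀ᵐ ω ∂P, 0 ≤ c := by
    filter_upwards [hlim] with ω hω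
    exact (ge_of_tendsto' hω fun n => hf0 n ω).trans hac
  have hmin : Tendsto (fun n => ∫ ω, min (f n ω) c ∂P) atTop (𝓝 (∫ _, a ∂P)) := by
    refine tendsto_integral_of_dominated_convergence (fun _ => c)
      (fun n => ((hf n).min measurable_const).aestronglyMeasurable) (integrable_const c)
      (fun n => ?_) ?_
    · filter_upwards [h0c] with ω hω
      rw [Real.norm_eq_abs, abs_of_nonneg (le_min (hf0 n ω) hω)]
      exact min_le_right _ _
    · filter_upwards [hlim] with ω hω
      have := hω.min (tendsto_const_nhds (x := c))
      rwa [min_eq_left hac] at this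
  rw [integral_const, probReal_univ, one_smul] at hmin
  have hminint : ∀ n, Integrable (fun ω => min (f n ω) c) P := fun n =>
    (hfint n).inf (integrable_const c)
  have hup : Tendsto (fun n => ∫ ω, min (f n ω) c ∂P + ∫ ω, |g n ω - c| ∂P) atTop (𝓝 a) := by
    simpa using hmin.add hgc
  refine tendsto_of_tendsto_of_tendsto_of_le_of_le hmin hup
    (fun n => integral_mono (hminint n) (hfint n) fun ω => min_le_left _ _) fun n => ?_
  have habs : Integrable (fun ω => |g n ω - c|) P := ((hg n).sub (integrable_const c)).abs
  change ∫ ω, f n ω ∂P ≤ ∫ ω, min (f n ω) c ∂P + ∫ ω, |g n ω - c| ∂P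
  rw [← integral_add (hminint n) habs]
  refine integral_mono (hfint n) ((hminint n).add habs) fun ω => ?_
  change f n ω ≤ min (f n ω) c + |g n ω - c|
  have h1 := hfg n ω
  rcases le_total (f n ω) c with h | h
  · rw [min_eq_left h]; linarith [abs_nonneg (g n ω - c)]
  · rw [min_eq_right h]; linarith [le_abs_self (g n ω - c)]

section IID

variable (μ : Measure ℝ) [IsProbabilityMeasure μ]

/-- The law of an infinite i.i.d. sequence. -/
noncomputable abbrev iidLaw : Measure (ℕ → ℝ) := Measure.infinitePi fun _ : ℕ => μ

lemma integral_pi_eq_iidLaw (n : ℕ) {f : (Fin n → ℝ) → ℝ} (hf : Measurable f) :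
    ∫ x, f x ∂(Measure.pi fun _ : Fin n => μ) = ∫ ω, f (fun i => ω i) ∂(iidLaw μ) := by
  have h : (iidLaw μ).map (fun ω (i : Fin n) => ω i) = Measure.pi fun _ : Fin n => μ := by
    rw [← Measure.infinitePi_eq_pi]
    exact Measure.map_infinitePi_infinitePi_of_inj (P := fun _ : ℕ => μ) Fin.val_injective
  rw [← h, integral_map (measurable_pi_iff.2 fun i => measurable_pi_apply _).aemeasurable
    hf.aestronglyMeasurable]

variable {μ} {φ : ℝ → ℝ}

lemma pairwise_indepFun_iidLaw (hφ : Measurable φ) :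
    Pairwise (Function.onFun (ProbabilityTheory.IndepFun · · (iidLaw μ))
      fun (i : ℕ) (ω : ℕ → ℝ) => φ (ω i)) :=
  fun _ _ hij => (ProbabilityTheory.iIndepFun_infinitePi (P := fun _ : ℕ => μ)
    (X := fun _ => φ) fun _ => hφ).indepFun hij

lemma identDistrib_iidLaw (hφ : Measurable φ) (i : ℕ) :
    ProbabilityTheory.IdentDistrib (fun ω : ℕ → ℝ => φ (ω i)) (fun ω => φ (ω 0))
      (iidLaw μ) (iidLaw μ) := by
  have h : ProbabilityTheory.IdentDistrib (fun ω : ℕ → ℝ => ω i) (fun ω => ω 0)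
      (iidLaw μ) (iidLaw μ) :=
    ⟨(measurable_pi_apply i).aemeasurable, (measurable_pi_apply 0).aemeasurable, by
      rw [Measure.infinitePi_map_eval, Measure.infinitePi_map_eval]⟩
  exact h.comp hφ

lemma integrable_iidLaw (hφ : Integrable φ μ) (i : ℕ) :
    Integrable (fun ω : ℕ → ℝ => φ (ω i)) (iidLaw μ) :=
  (measurePreserving_eval_infinitePi (fun _ : ℕ => μ) i).integrable_comp_of_integrable hφ

lemma integral_iidLaw (hφ : Measurable φ) (i : ℕ) :
    ∫ ω, φ (ω i) ∂(iidLaw μ) = ∫ t, φ t ∂μ := by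
  conv_rhs => rw [← Measure.infinitePi_map_eval (fun _ : ℕ => μ) i]
  rw [integral_map (measurable_pi_apply i).aemeasurable hφ.aestronglyMeasurable]

lemma ae_tendsto_mean (hφ : Measurable φ) (hint : Integrable φ μ) :
    ∀ᵐ ω ∂(iidLaw μ), Tendsto (fun n : ℕ => (n : ℝ)⁻¹ * ∑ i : Fin n, φ (ω i)) atTop
      (𝓝 (∫ t, φ t ∂μ)) := by
  have h := ProbabilityTheory.strong_law_ae_real (fun (i : ℕ) (ω : ℕ → ℝ) => φ (ω i))
    (integrable_iidLaw hint 0) (pairwise_indepFun_iidLaw hφ) (identDistrib_iidLaw hφ)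
  rw [integral_iidLaw hφ] at h
  filter_upwards [h] with ω hω
  refine hω.congr fun n => ?_
  rw [Fin.sum_univ_eq_sum_range fun i => φ (ω i), div_eq_inv_mul]

lemma integrable_mean (hint : Integrable φ μ) (n : ℕ) :
    Integrable (fun ω : ℕ → ℝ => (n : ℝ)⁻¹ * ∑ i : Fin n, φ (ω i)) (iidLaw μ) :=
  (integrable_finsetSum _ fun i _ => integrable_iidLaw hint (i : Fin n)).const_mul _

lemma tendsto_integral_abs_mean_sub (hφ : Measurable φ) (hint : Integrable φ μ) :
    Tendsto (fun n : ℕ => ∫ ω, |(n : ℝ)⁻¹ * ∑ i : Fin n, φ (ω i) - ∫ t, φ t ∂μ| ∂(iidLaw μ))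
      atTop (𝓝 0) := by
  have h := ProbabilityTheory.strong_law_Lp le_rfl ENNReal.one_ne_top
    (fun (i : ℕ) (ω : ℕ → ℝ) => φ (ω i))
    (memLp_one_iff_integrable.2 (integrable_iidLaw hint 0)) (pairwise_indepFun_iidLaw hφ)
    (identDistrib_iidLaw hφ)
  rw [integral_iidLaw hφ] at h
  have h' := (ENNReal.tendsto_toReal ENNReal.zero_ne_top).comp h
  rw [ENNReal.toReal_zero] at h'
  refine h'.congr fun n => ?_
  have hint' := (integrable_mean hint n).sub (integrable_const (∫ t, φ t ∂μ))
  simp only [Function.comp_apply, smul_eq_mul]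
  rw [eLpNorm_one_eq_lintegral_enorm]
  simp only [← Fin.sum_univ_eq_sum_range]
  rw [← integral_norm_eq_lintegral_enorm]
  · rfl
  · exact hint'.aestronglyMeasurable

/-- Order statistics of i.i.d. samples converge to the quantiles. -/
lemma ae_tendsto_percentileMech
    (hinc : ∀ q t : ℝ, q < t → 0 < μ (Set.Iic q) → 0 < μ (Set.Ioi q) → 0 < μ (Set.Ioc q t))
    {k : ℕ} {v : Fin k → ℝ} (hv : ∀ j, v j ∈ Set.Ioo (0 : ℝ) 1) :
    ∀ᵐ ω ∂(iidLaw μ), Tendsto (fun n : ℕ => percentileMech v fun i : Fin n => ω i) atTop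
      (𝓝 fun j => mquantile μ (v j)) := by
  have hcdf : ∀ r : ℚ, ∀ᵐ ω ∂(iidLaw μ), Tendsto (fun n : ℕ => (n : ℝ)⁻¹ *
      ∑ i : Fin n, (Set.Iic (r : ℝ)).indicator (fun _ => (1 : ℝ)) (ω i)) atTop
      (𝓝 (mcdf μ r)) := by
    intro r
    have h := ae_tendsto_mean (μ := μ) (φ := (Set.Iic (r : ℝ)).indicator fun _ => (1 : ℝ))
      (measurable_const.indicator measurableSet_Iic)
      ((integrable_const _).indicator measurableSet_Iic)
    rwa [integral_indicator_const _ measurableSet_Iic, smul_eq_mul, mul_one] at h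
  filter_upwards [ae_all_iff.2 hcdf] with ω hω
  refine tendsto_pi_nhds.2 fun j => tendsto_order.2 ⟨fun a ha => ?_, fun b hb => ?_⟩
  · obtain ⟨r, har, hrq⟩ := exists_rat_btwn ha
    have hF := mcdf_lt_of_lt_mquantile (hv j).1 hrq
    have hlim : Tendsto (fun n : ℕ => (n : ℝ)⁻¹ *
        ∑ i : Fin n, (Set.Iic (r : ℝ)).indicator (fun _ => (1 : ℝ)) (ω i) -
        (1 - (n : ℝ)⁻¹) * v j) atTop (𝓝 (mcdf μ r - (1 - 0) * v j)) :=
      (hω r).sub ((tendsto_const_nhds.sub tendsto_inv_atTop_nhds_zero_nat).mul_const _)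
    have hneg : mcdf μ r - (1 - 0) * v j < 0 := by linarith
    filter_upwards [hlim.eventually (gt_mem_nhds hneg), eventually_gt_atTop 0] with n hn hn0
    refine har.trans (not_le.1 fun hle => ?_)
    have h := (percentileMech_le_iff hn0 (hv j) _ _).1 hle
    have hn0' : (0 : ℝ) < n := by exact_mod_cast hn0
    have h2 := mul_lt_mul_of_pos_left h (inv_pos.2 hn0')
    have h3 : (n : ℝ)⁻¹ * (((n : ℝ) - 1) * v j) = (1 - (n : ℝ)⁻¹) * v j := by field_simp
    linarith
  · obtain ⟨r, hqr, hrb⟩ := exists_rat_btwn hb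
    have hF := lt_mcdf_of_mquantile_lt hinc (hv j) hqr
    filter_upwards [(hω r).eventually (lt_mem_nhds hF), eventually_gt_atTop 0] with n hn hn0
    refine lt_of_le_of_lt ((percentileMech_le_iff hn0 (hv j) _ _).2 ?_) hrb
    have hn0' : (0 : ℝ) < n := by exact_mod_cast hn0
    rw [← div_eq_inv_mul, lt_div_iff₀ hn0'] at hn
    linarith [(hv j).1]

lemma ae_tendsto_SC (hint : Integrable (fun x : ℝ => |x|) μ) {k : ℕ} [Nonempty (Fin k)]
    (y : Fin k → ℝ) :
    ∀ᵐ ω ∂(iidLaw μ), Tendsto (fun n : ℕ => SC (fun i : Fin n => ω i) y) atTop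
      (𝓝 (∫ t, nearDist y t ∂μ)) :=
  ae_tendsto_mean (continuous_nearDist_right y).measurable (integrable_nearDist y hint)

lemma ae_tendsto_SCv
    (hinc : ∀ q t : ℝ, q < t → 0 < μ (Set.Iic q) → 0 < μ (Set.Ioi q) → 0 < μ (Set.Ioc q t))
    (hint : Integrable (fun x : ℝ => |x|) μ) {k : ℕ} [Nonempty (Fin k)] {v : Fin k → ℝ}
    (hv : ∀ j, v j ∈ Set.Ioo (0 : ℝ) 1) :
    ∀ᵐ ω ∂(iidLaw μ), Tendsto (fun n : ℕ => SCv v fun i : Fin n => ω i) atTop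
      (𝓝 (∫ t, nearDist (fun j => mquantile μ (v j)) t ∂μ)) := by
  filter_upwards [ae_tendsto_percentileMech hinc hv,
    ae_tendsto_SC hint fun j => mquantile μ (v j)] with ω h1 h2
  have h3 := tendsto_iff_dist_tendsto_zero.1 h1
  refine tendsto_of_tendsto_of_tendsto_of_le_of_le (by simpa using h2.sub h3)
    (by simpa using h2.add h3) (fun n => ?_) fun n => SC_le_add _ _ _
  have := SC_le_add (fun i : Fin n => ω i) (fun j => mquantile μ (v j))
    (percentileMech v fun i : Fin n => ω i)
  rw [dist_comm] at this
  change _ - _ ≤ SC _ _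
  linarith

lemma eventually_lt_SCopt (hint : Integrable (fun x : ℝ => |x|) μ) {k : ℕ} [Nonempty (Fin k)]
    {L : ℝ} (hL : L < projDist k μ) :
    ∀ᵐ ω ∂(iidLaw μ), ∀ᶠ n : ℕ in atTop, L ≤ SCopt k fun i : Fin n => ω i := by
  have hid : Integrable (fun x : ℝ => x) μ :=
    (integrable_norm_iff measurable_id.aestronglyMeasurable).1 hint
  set D := projDist k μ with hDdef
  have hD : ∀ y : Fin k → ℝ, D ≤ ∫ t, nearDist y t ∂μ := fun y => by
    rw [hDdef, projDist_eq_iInf hint]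
    exact ciInf_le ⟨0, by rintro _ ⟨y, rfl⟩; exact integral_nonneg (nearDist_nonneg y)⟩ y
  have hD0 : 0 ≤ D := by
    rw [hDdef, projDist_eq_iInf hint]
    exact Real.iInf_nonneg fun y => integral_nonneg (nearDist_nonneg y)
  obtain ⟨ε, hε0, hε1, hεL⟩ : ∃ ε : ℝ, 0 < ε ∧ ε < 1 ∧ L ≤ (1 - ε) * (D - ε) - 2 * ε := by
    refine ⟨min (1 / 2) ((D - L) / (D + 3)), by positivity [sub_pos.2 hL], by
      have := min_le_left (1 / 2) ((D - L) / (D + 3)); linarith, ?_⟩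
    have h1 := min_le_right (1 / 2) ((D - L) / (D + 3))
    rw [le_div_iff₀ (by positivity)] at h1
    nlinarith [sq_nonneg (min (1 / 2) ((D - L) / (D + 3)))]
  obtain ⟨f, hf, hfint⟩ := (memLp_one_iff_integrable.2 hid).exists_simpleFunc_eLpNorm_sub_lt
    ENNReal.one_ne_top (ε := ENNReal.ofReal ε) (by simpa using hε0)
  have hfint : Integrable f μ := memLp_one_iff_integrable.1 hfint
  have hdint : Integrable (fun t : ℝ => |t - f t|) μ := (hid.sub hfint).abs
  have hd : ∫ t, |t - f t| ∂μ < ε := by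
    rw [eLpNorm_one_eq_lintegral_enorm] at hf
    have : ∫ t, |t - f t| ∂μ = (∫⁻ t, ‖t - f t‖ₑ ∂μ).toReal :=
      integral_norm_eq_lintegral_enorm (hid.sub hfint).aestronglyMeasurable
    rw [this]
    exact (ENNReal.toReal_lt_of_lt_ofReal hf)
  have hdecomp : ∀ (y : Fin k → ℝ) (t : ℝ), nearDist y (f t) =
      ∑ a ∈ f.range, (f ⁻¹' {a}).indicator (fun _ => (1 : ℝ)) t * nearDist y a := by
    intro y t
    rw [Finset.sum_eq_single (f t)]
    · simp
    · intro a _ ha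
      simp [ha.symm]
    · intro h
      exact absurd (f.mem_range_self t) h
  have hind : ∀ a, Integrable ((f ⁻¹' {a}).indicator fun _ => (1 : ℝ)) μ := fun a =>
    (integrable_const _).indicator (f.measurableSet_fiber a)
  have hfreq : ∀ᵐ ω ∂(iidLaw μ), ∀ a ∈ f.range, Tendsto (fun n : ℕ => (n : ℝ)⁻¹ *
      ∑ i : Fin n, (f ⁻¹' {a}).indicator (fun _ => (1 : ℝ)) (ω i)) atTop
      (𝓝 (μ.real (f ⁻¹' {a}))) := by
    refine (Finset.eventually_all f.range).2 fun a _ => ?_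
    have h := ae_tendsto_mean (measurable_const.indicator (f.measurableSet_fiber a)) (hind a)
    rwa [integral_indicator_const _ (f.measurableSet_fiber a), smul_eq_mul, mul_one] at h
  filter_upwards [hfreq, ae_tendsto_mean (φ := fun t => |t - f t|)
    (by have := f.measurable; fun_prop) hdint] with ω hω1 hω2
  have hev : ∀ᶠ n : ℕ in atTop, ∀ a ∈ f.range, (1 - ε) * μ.real (f ⁻¹' {a}) ≤ (n : ℝ)⁻¹ *
      ∑ i : Fin n, (f ⁻¹' {a}).indicator (fun _ => (1 : ℝ)) (ω i) := by
    refine (Finset.eventually_all f.range).2 fun a ha => ?_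
    rcases (measureReal_nonneg (μ := μ) (s := f ⁻¹' {a})).eq_or_lt with h0 | h0
    · refine Eventually.of_forall fun n => ?_
      rw [← h0, mul_zero]
      exact mul_nonneg (by positivity) (Finset.sum_nonneg fun i _ =>
        Set.indicator_nonneg (fun _ _ => zero_le_one) _)
    · refine ((hω1 a ha).eventually (lt_mem_nhds ?_)).mono fun n hn => le_of_lt hn
      nlinarith
  filter_upwards [hev, hω2.eventually (gt_mem_nhds hd)] with n hn1 hn2
  refine hεL.trans (le_ciInf fun y => ?_)
  have hsample : (n : ℝ)⁻¹ * ∑ i : Fin n, nearDist y (f (ω i)) ≤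
      SC (fun i : Fin n => ω i) y + (n : ℝ)⁻¹ * ∑ i : Fin n, |ω i - f (ω i)| := by
    rw [SC_eq, ← mul_add, ← Finset.sum_add_distrib]
    refine mul_le_mul_of_nonneg_left (Finset.sum_le_sum fun i _ => ?_) (by positivity)
    have := nearDist_le_add y (f (ω i)) y (ω i)
    rwa [dist_self, add_zero, abs_sub_comm] at this
  have hfreq_sum : (n : ℝ)⁻¹ * ∑ i : Fin n, nearDist y (f (ω i)) = ∑ a ∈ f.range, ((n : ℝ)⁻¹ *
      ∑ i : Fin n, (f ⁻¹' {a}).indicator (fun _ => (1 : ℝ)) (ω i)) * nearDist y a := by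
    simp_rw [hdecomp y]
    rw [Finset.sum_comm, Finset.mul_sum]
    exact Finset.sum_congr rfl fun a _ => by rw [← Finset.sum_mul, mul_assoc]
  have hmean_sum : ∫ t, nearDist y (f t) ∂μ =
      ∑ a ∈ f.range, μ.real (f ⁻¹' {a}) * nearDist y a := by
    simp_rw [hdecomp y]
    rw [integral_finsetSum _ fun a _ => (hind a).mul_const _]
    refine Finset.sum_congr rfl fun a _ => ?_
    rw [integral_mul_const, integral_indicator_const _ (f.measurableSet_fiber a), smul_eq_mul,
      mul_one]
  have hcompare : (1 - ε) * ∫ t, nearDist y (f t) ∂μ ≤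
      (n : ℝ)⁻¹ * ∑ i : Fin n, nearDist y (f (ω i)) := by
    rw [hfreq_sum, hmean_sum, Finset.mul_sum]
    refine Finset.sum_le_sum fun a ha => ?_
    rw [← mul_assoc]
    exact mul_le_mul_of_nonneg_right (hn1 a ha) (nearDist_nonneg y a)
  have hmeanint : Integrable (fun t => nearDist y (f t)) μ := by
    simp_rw [hdecomp y]
    exact integrable_finsetSum _ fun a _ => (hind a).mul_const _
  have hmean : ∫ t, nearDist y t ∂μ ≤ ∫ t, nearDist y (f t) ∂μ + ∫ t, |t - f t| ∂μ := by
    rw [← integral_add hmeanint hdint]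
    refine integral_mono (integrable_nearDist y hint) (hmeanint.add hdint) fun t => ?_
    have := nearDist_le_add y t y (f t)
    rwa [dist_self, add_zero] at this
  have h1 : D - ε ≤ ∫ t, nearDist y (f t) ∂μ := by linarith [hD y]
  have h2 := mul_le_mul_of_nonneg_left h1 (by linarith : 0 ≤ 1 - ε)
  linarith

lemma ae_tendsto_SCopt (hint : Integrable (fun x : ℝ => |x|) μ) {k : ℕ} [Nonempty (Fin k)] :
    ∀ᵐ ω ∂(iidLaw μ), Tendsto (fun n : ℕ => SCopt k fun i : Fin n => ω i) atTop
      (𝓝 (projDist k μ)) := by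
  have hlow : ∀ r : {r : ℚ // (r : ℝ) < projDist k μ}, ∀ᵐ ω ∂(iidLaw μ), ∀ᶠ n : ℕ in atTop,
      (r : ℝ) ≤ SCopt k fun i : Fin n => ω i := fun r => eventually_lt_SCopt hint r.2
  have hupp : ∀ r : {r : ℚ // projDist k μ < (r : ℝ)}, ∀ᵐ ω ∂(iidLaw μ), ∀ᶠ n : ℕ in atTop,
      (SCopt k fun i : Fin n => ω i) < (r : ℝ) := by
    rintro ⟨r, hr⟩
    rw [projDist_eq_iInf hint] at hr
    obtain ⟨y, hy⟩ := exists_lt_of_ciInf_lt hr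
    filter_upwards [ae_tendsto_SC hint y] with ω hω
    filter_upwards [hω.eventually (gt_mem_nhds hy)] with n hn
    exact (SCopt_le _ y).trans_lt hn
  filter_upwards [ae_all_iff.2 hlow, ae_all_iff.2 hupp] with ω h1 h2
  refine tendsto_order.2 ⟨fun a ha => ?_, fun b hb => ?_⟩
  · obtain ⟨r, har, hr⟩ := exists_rat_btwn ha
    exact (h1 ⟨r, hr⟩).mono fun n hn => har.trans_le hn
  · obtain ⟨r, hr, hrb⟩ := exists_rat_btwn hb
    exact (h2 ⟨r, hr⟩).mono fun n hn => hn.trans hrb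

lemma tendsto_integral_iidLaw (hint : Integrable (fun x : ℝ => |x|) μ)
    {f : ∀ n : ℕ, (Fin n → ℝ) → ℝ} {a C : ℝ} (hf : ∀ n, Measurable (f n))
    (hf0 : ∀ n x, 0 ≤ f n x) (hfC : ∀ n x, f n x ≤ C * ((n : ℝ)⁻¹ * ∑ i, |x i|)) (hC : 0 ≤ C)
    (hlim : ∀ᵐ ω ∂(iidLaw μ), Tendsto (fun n => f n fun i => ω i) atTop (𝓝 a)) :
    Tendsto (fun n => ∫ x, f n x ∂(Measure.pi fun _ : Fin n => μ)) atTop (𝓝 a) := by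
  simp_rw [fun n => integral_pi_eq_iidLaw μ n (hf n)]
  refine tendsto_integral_of_dominated_seq (c := C * ∫ t, |t| ∂μ)
    (g := fun n ω => C * ((n : ℝ)⁻¹ * ∑ i : Fin n, |ω i|))
    (fun n => (hf n).comp (by fun_prop)) (fun n ω => hf0 n _) (fun n ω => hfC n _)
    (fun n => (integrable_mean hint n).const_mul C) hlim ?_ ?_
  · obtain ⟨ω, h1, h2⟩ := (hlim.and (ae_tendsto_mean (by fun_prop) hint)).exists
    exact le_of_tendsto_of_tendsto' h1 (h2.const_mul C) fun n => hfC n _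
  · have h := (tendsto_integral_abs_mean_sub (by fun_prop) hint).const_mul C
    rw [mul_zero] at h
    refine h.congr fun n => ?_
    rw [← integral_const_mul]
    refine integral_congr_ae (ae_of_all _ fun ω => ?_)
    simp only
    rw [← mul_sub, abs_mul, abs_of_nonneg hC]

end IID

lemma SCopt_le_mean {n k : ℕ} [Nonempty (Fin k)] (x : Fin n → ℝ) :
    SCopt k x ≤ 1 * ((n : ℝ)⁻¹ * ∑ i, |x i|) := by
  have h := (SCopt_le x (0 : Fin k → ℝ)).trans (SC_le_mean_add x 0)
  rwa [norm_zero, add_zero, ← one_mul ((n : ℝ)⁻¹ * _)] at h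

lemma SCv_le_mean {n k : ℕ} [Nonempty (Fin k)] {v : Fin k → ℝ}
    (hv : ∀ j, v j ∈ Set.Ioo (0 : ℝ) 1) (x : Fin n → ℝ) :
    SCv v x ≤ (1 + ∑ j, (2 / v j + 1 / (1 - v j))) * ((n : ℝ)⁻¹ * ∑ i, |x i|) := by
  have hM : 0 ≤ (n : ℝ)⁻¹ * ∑ i, |x i| :=
    mul_nonneg (by positivity) (Finset.sum_nonneg fun i _ => abs_nonneg _)
  have hc : ∀ j, 0 ≤ 2 / v j + 1 / (1 - v j) := fun j =>
    add_nonneg (div_nonneg zero_le_two (hv j).1.le)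
      (div_nonneg zero_le_one (sub_nonneg.2 (hv j).2.le))
  refine (SC_le_mean_add x _).trans ?_
  rw [add_mul, one_mul]
  refine add_le_add_right ((pi_norm_le_iff_of_nonneg
    (mul_nonneg (Finset.sum_nonneg fun j _ => hc j) hM)).2 fun j => ?_) _
  rw [Real.norm_eq_abs]
  refine (abs_percentileMech_le (hv j) x).trans (mul_le_mul_of_nonneg_right ?_ hM)
  exact Finset.single_le_sum (f := fun j => 2 / v j + 1 / (1 - v j)) (fun j _ => hc j)
    (Finset.mem_univ j)

/-- The Bayesian approximation ratio of the percentile mechanism converges to the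
(finite) ratio `W₁(μ, ν_{Q_v}) / inf_{ν ∈ 𝒫_k} W₁(μ, ν)`. -/
theorem stmt6 (μ : Measure ℝ) (hμ : BasicAssumptions μ)
    (hint : Integrable (fun x : ℝ => |x|) μ) {k : ℕ} (hk : 1 ≤ k)
    (v : Fin k → ℝ) (hv : Monotone v) (hv01 : ∀ j, v j ∈ Set.Ioo (0 : ℝ) 1) :
    Tendsto (fun n : ℕ =>
        (∫ x : Fin n → ℝ, SCv v x ∂(Measure.pi fun _ : Fin n => μ)) /
          (∫ x : Fin n → ℝ, SCopt k x ∂(Measure.pi fun _ : Fin n => μ)))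
      atTop (𝓝 (W1 μ (nuQ μ v) / projDist k μ)) := by
  have := hμ.1
  have : Nonempty (Fin k) := Fin.pos_iff_nonempty.1 hk
  have hmono : Monotone fun j => mquantile μ (v j) := fun i j hij =>
    mquantile_mono (hv01 i).1 (hv01 j).2 (hv hij)
  have hW : W1 μ (nuQ μ v) = ∫ t, nearDist (fun j => mquantile μ (v j)) t ∂μ :=
    W1_voronoiMeasure μ hint hmono
  rw [hW]
  refine Tendsto.div ?_ ?_ (projDist_pos hint hμ.absolutelyContinuous).ne'
  · refine tendsto_integral_iidLaw hint (fun n => measurable_SCv hv01)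
      (fun n x => SC_nonneg _ _) (fun n x => SCv_le_mean hv01 x) ?_
      (ae_tendsto_SCv hμ.measure_Ioc_pos hint hv01)
    exact add_nonneg zero_le_one (Finset.sum_nonneg fun j _ =>
      add_nonneg (div_nonneg zero_le_two (hv01 j).1.le)
        (div_nonneg zero_le_one (sub_nonneg.2 (hv01 j).2.le)))
  · exact tendsto_integral_iidLaw hint (fun n => measurable_SCopt n k)
      (fun n x => SCopt_nonneg k x) (fun n x => SCopt_le_mean x) zero_le_one
      (ae_tendsto_SCopt hint)
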